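/- arXiv:2002.02398 — 4 statements merged into one kernel-verified Lean document; each statement's English description precedes it below -/
import Mathlib

section
/- Let x₀ ∈ (0,1) and T > 0. Assume there exist δ > 0 and a strictly increasing sequence (n_k) of positive integers such that |sin(n_k π x₀)| ≤ e^{-n_k² π² (T+δ)} for every k (this holds whenever T is smaller than the minimal pointwise control time T₀ at x₀). Then there exist a sequence of positive reals ε_k → 0 and constants C₁ > 0 and C₂ > 1/2 such that for every k, the internal observability constant satisfies C(T, ε_k) ≤ C₁ ε_k^{C₂}. -/
open MeasureTheory Real Set Filter

/-- Solution of the 1D Dirichlet heat equation with initial datum `∑ μₙ sin(nπx)`. -/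
noncomputable def heatSol (μ : ℕ+ → ℝ) (t x : ℝ) : ℝ :=
  ∑' n : ℕ+, μ n * Real.exp (-(n : ℝ) ^ 2 * π ^ 2 * t) * Real.sin ((n : ℝ) * π * x)

/-- The internal observability constant `C(T,ε)` on the interval `(x₀-ε, x₀+ε)`. -/
noncomputable def obsConst (x₀ T ε : ℝ) : ℝ :=
  Real.sqrt (sInf {c : ℝ | ∃ μ : ℕ+ → ℝ, (∑' n : ℕ+, (μ n) ^ 2) = 1 ∧
      c = ∫ t in (0 : ℝ)..T, ∫ x in (x₀ - ε)..(x₀ + ε), (heatSol μ t x) ^ 2})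

theorem heatSol_single (n : ℕ+) (t x : ℝ) :
    heatSol (Pi.single n 1) t x =
      Real.exp (-(n : ℝ) ^ 2 * π ^ 2 * t) * Real.sin ((n : ℝ) * π * x) := by
  unfold heatSol
  rw [tsum_eq_single n]
  · simp
  · intro m hm
    simp [hm]

theorem obsConst_le_sqrt_of_unit {x₀ T ε : ℝ} (hT : 0 ≤ T) (hε : 0 ≤ ε) (μ : ℕ+ → ℝ)
    (hμ : ∑' n : ℕ+, (μ n) ^ 2 = 1) :
    obsConst x₀ T ε ≤
      Real.sqrt (∫ t in (0 : ℝ)..T, ∫ x in (x₀ - ε)..(x₀ + ε), (heatSol μ t x) ^ 2) := by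
  refine Real.sqrt_le_sqrt (csInf_le ⟨0, ?_⟩ ⟨μ, hμ, rfl⟩)
  rintro c ⟨ν, -, rfl⟩
  exact intervalIntegral.integral_nonneg hT fun t _ =>
    intervalIntegral.integral_nonneg (by linarith) fun x _ => sq_nonneg _

theorem integral_exp_neg_mul_le {a T : ℝ} (ha : 0 < a) :
    ∫ t in (0 : ℝ)..T, Real.exp (-a * t) ≤ 1 / a := by
  rw [intervalIntegral.integral_comp_mul_left (fun t => Real.exp t) (neg_ne_zero.mpr ha.ne'),
    integral_exp, mul_zero, Real.exp_zero, smul_eq_mul, inv_neg, one_div]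
  have h : 0 < a⁻¹ * Real.exp (-a * T) := by positivity
  linarith

theorem integral_sin_sq_le_of_abs_sin_le {x₀ ε b : ℝ} (hb : 0 ≤ b) (hε : 0 ≤ ε)
    (h : |Real.sin (b * x₀)| ≤ ε) :
    ∫ x in (x₀ - ε)..(x₀ + ε), Real.sin (b * x) ^ 2 ≤ 2 * ε * (ε * (1 + b)) ^ 2 := by
  have hbound : ∀ x ∈ Set.Icc (x₀ - ε) (x₀ + ε), Real.sin (b * x) ^ 2 ≤ (ε * (1 + b)) ^ 2 := by
    intro x hx
    have hx' : |x - x₀| ≤ ε := abs_le.mpr ⟨by linarith [hx.1], by linarith [hx.2]⟩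
    have hlip : |Real.sin (b * x) - Real.sin (b * x₀)| ≤ b * ε := by
      refine (Real.abs_sin_sub_sin_le _ _).trans ?_
      rw [← mul_sub, abs_mul, abs_of_nonneg hb]
      gcongr
    have htri := abs_sub_abs_le_abs_sub (Real.sin (b * x)) (Real.sin (b * x₀))
    rw [← sq_abs]
    gcongr
    linarith
  calc ∫ x in (x₀ - ε)..(x₀ + ε), Real.sin (b * x) ^ 2
      ≤ ∫ _ in (x₀ - ε)..(x₀ + ε), (ε * (1 + b)) ^ 2 :=
        intervalIntegral.integral_mono_on (by linarith)
          (Continuous.intervalIntegrable (by fun_prop) _ _) (by simp) hbound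
    _ = 2 * ε * (ε * (1 + b)) ^ 2 := by
        rw [intervalIntegral.integral_const, smul_eq_mul]
        ring

theorem obsConst_le_of_abs_sin_le {x₀ T ε : ℝ} (hT : 0 ≤ T) (hε : 0 < ε) (n : ℕ+)
    (h : |Real.sin ((n : ℝ) * π * x₀)| ≤ ε) :
    obsConst x₀ T ε ≤ 2 * ε ^ (3 / 2 : ℝ) := by
  have hn : (1 : ℝ) ≤ n := by exact_mod_cast n.pos
  have hb : 1 ≤ (n : ℝ) * π := by nlinarith [Real.pi_gt_three]
  set b : ℝ := (n : ℝ) * π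
  refine (obsConst_le_sqrt_of_unit hT hε.le (Pi.single n 1) ?_).trans ?_
  · rw [tsum_eq_single n]
    · simp
    · intro m hm
      simp [hm]
  have hsplit : ∫ t in (0 : ℝ)..T, ∫ x in (x₀ - ε)..(x₀ + ε),
        (heatSol (Pi.single n 1) t x) ^ 2 =
      (∫ t in (0 : ℝ)..T, Real.exp (-(2 * b ^ 2) * t)) *
        ∫ x in (x₀ - ε)..(x₀ + ε), Real.sin (b * x) ^ 2 := by
    rw [← intervalIntegral.integral_mul_const]
    congr 1
    funext t
    rw [← intervalIntegral.integral_const_mul]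
    congr 1
    funext x
    rw [heatSol_single, mul_pow, ← Real.exp_nat_mul]
    congr 2
    simp only [b]
    push_cast
    ring
  rw [hsplit, Real.sqrt_le_iff]
  refine ⟨by positivity, ?_⟩
  have hpow : (2 * ε ^ (3 / 2 : ℝ)) ^ 2 = 4 * ε ^ 3 := by
    rw [mul_pow, ← Real.rpow_mul_natCast hε.le]
    norm_num
  have hsin_nonneg : 0 ≤ ∫ x in (x₀ - ε)..(x₀ + ε), Real.sin (b * x) ^ 2 :=
    intervalIntegral.integral_nonneg (by linarith) fun x _ => sq_nonneg _
  calc (∫ t in (0 : ℝ)..T, Real.exp (-(2 * b ^ 2) * t)) *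
        ∫ x in (x₀ - ε)..(x₀ + ε), Real.sin (b * x) ^ 2
      ≤ 1 / (2 * b ^ 2) * (2 * ε * (ε * (1 + b)) ^ 2) :=
        mul_le_mul (integral_exp_neg_mul_le (by positivity))
          (integral_sin_sq_le_of_abs_sin_le (by linarith) hε.le h) hsin_nonneg (by positivity)
    _ ≤ 1 / (2 * b ^ 2) * (2 * ε * (ε * (b + b)) ^ 2) := by gcongr
    _ = (2 * ε ^ (3 / 2 : ℝ)) ^ 2 := by
        rw [hpow]
        field_simp
        ring

theorem tendsto_exp_neg_sq_mul_atTop {nk : ℕ → ℕ+} (hnk : StrictMono nk) {s : ℝ} (hs : 0 < s) :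
    Tendsto (fun k => Real.exp (-(nk k : ℝ) ^ 2 * π ^ 2 * s)) atTop (nhds 0) := by
  have hle : ∀ k : ℕ, k ≤ (nk k : ℕ) := fun _ =>
    StrictMono.le_apply (f := fun k => (nk k : ℕ)) fun _ _ hij => hnk hij
  have htop : Tendsto (fun k => (nk k : ℝ)) atTop atTop :=
    tendsto_natCast_atTop_atTop.comp (tendsto_atTop_mono hle tendsto_id)
  refine Real.tendsto_exp_atBot.comp ?_
  have hsq := ((tendsto_pow_atTop two_ne_zero).comp htop).atTop_mul_const
    (show 0 < π ^ 2 * s by positivity)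
  refine (tendsto_neg_atTop_atBot.comp hsq).congr fun k => ?_
  simp only [Function.comp_apply]
  ring

/-- Case `T < T₀`: if there are `δ > 0` and a strictly increasing sequence `(n_k)` of
positive integers with `|sin(n_k π x₀)| ≤ e^{-n_k² π² (T+δ)}`, then there are a sequence
`ε_k → 0⁺` and constants `C₁ > 0`, `C₂ > 1/2` with `C(T, ε_k) ≤ C₁ ε_k^{C₂}` for all `k`. -/
theorem obsConst_upper_bound_below_minimal_time (x₀ T : ℝ) (hx₀ : x₀ ∈ Set.Ioo (0 : ℝ) 1)
    (hT : 0 < T)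
    (hδ : ∃ δ : ℝ, 0 < δ ∧ ∃ nk : ℕ → ℕ+, StrictMono nk ∧
      ∀ k : ℕ, |Real.sin ((nk k : ℝ) * π * x₀)| ≤
        Real.exp (-(nk k : ℝ) ^ 2 * π ^ 2 * (T + δ))) :
    ∃ ε : ℕ → ℝ, (∀ k, 0 < ε k) ∧ (∀ k, ε k < min x₀ (1 - x₀)) ∧
      Filter.Tendsto ε Filter.atTop (nhds 0) ∧
      ∃ C₁ > (0 : ℝ), ∃ C₂ : ℝ, 1 / 2 < C₂ ∧
        ∀ k : ℕ, obsConst x₀ T (ε k) ≤ C₁ * (ε k) ^ C₂ := by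
  obtain ⟨δ, hδ, nk, hnk, hsin⟩ := hδ
  have htend := tendsto_exp_neg_sq_mul_atTop hnk (add_pos hT hδ)
  have hmin : 0 < min x₀ (1 - x₀) := lt_min hx₀.1 (sub_pos.mpr hx₀.2)
  obtain ⟨K, hK⟩ := eventually_atTop.mp (htend.eventually_lt_const hmin)
  exact ⟨fun k => Real.exp (-(nk (k + K) : ℝ) ^ 2 * π ^ 2 * (T + δ)),
    fun k => Real.exp_pos _, fun k => hK (k + K) (Nat.le_add_left K k),
    htend.comp (tendsto_add_atTop_nat K), 2, two_pos, 3 / 2, by norm_num,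
    fun k => obsConst_le_of_abs_sin_le hT.le (Real.exp_pos _) (nk (k + K)) (hsin (k + K))⟩
end

section
/- For every δ > 0 there exist a constant C > 0 and a sequence (ε_j)_{j≥0} of reals in (0,1) such that ε_j → 0 as j → ∞, ε_j ≥ ε_{j+1} ≥ ε_j/2 for every j, and for every j and every integer n ≥ 1: inf { |ε_j - p/n| : p ∈ ℤ } ≥ C ε_j e^{-n²π²δ}. -/
open MeasureTheory Real Set Filter

/-- The distance from `x` to the lattice `(1/n)ℤ` of rationals with denominator `n`. -/
noncomputable def latticeDist (x : ℝ) (n : ℕ+) : ℝ :=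
  sInf {d : ℝ | ∃ p : ℤ, d = |x - (p : ℝ) / (n : ℝ)|}

/-- `√2 / 2` is badly approximable by rationals. -/
lemma inv_six_mul_sq_le_abs_sqrt_two_div_two_sub (n : ℕ+) (a : ℤ) :
    1 / (6 * (n : ℝ) ^ 2) ≤ |√2 / 2 - (a : ℝ) / (n : ℝ)| := by
  have hn : (1 : ℝ) ≤ (n : ℝ) := by exact_mod_cast n.pos
  have hn0 : (0 : ℝ) < n := by linarith
  have hs2 : √2 ^ 2 = 2 := Real.sq_sqrt (by norm_num)
  have hs0 : 0 ≤ √2 := Real.sqrt_nonneg 2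
  have hs : √2 ≤ 2 := by nlinarith
  have hirr : Irrational (√2 * ((n : ℕ) : ℝ) / ((2 : ℕ) : ℝ)) :=
    (irrational_sqrt_two.mul_natCast n.ne_zero).div_natCast two_ne_zero
  have hne : ((n : ℕ) : ℤ) ^ 2 - 2 * a ^ 2 ≠ 0 := by
    intro h
    have h' : (n : ℝ) ^ 2 - 2 * (a : ℝ) ^ 2 = 0 := by exact_mod_cast h
    have h2 : (√2 * ((n : ℕ) : ℝ) / ((2 : ℕ) : ℝ)) ^ 2 = (a : ℝ) ^ 2 := by
      push_cast
      rw [div_pow, mul_pow, hs2]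
      linarith
    rcases sq_eq_sq_iff_eq_or_eq_neg.mp h2 with h3 | h3
    · exact hirr.ne_int a h3
    · exact hirr.ne_int (-a) (by rw [h3]; push_cast; rfl)
  have hone : (1 : ℝ) ≤ |(n : ℝ) ^ 2 - 2 * (a : ℝ) ^ 2| := by
    exact_mod_cast Int.one_le_abs hne
  set x : ℝ := (a : ℝ) / n with hx
  have hax : (a : ℝ) = x * n := by rw [hx]; field_simp
  have hfac : (n : ℝ) ^ 2 - 2 * (a : ℝ) ^ 2 = 2 * n ^ 2 * ((√2 / 2 - x) * (√2 / 2 + x)) := by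
    rw [hax]
    linear_combination (-(n : ℝ) ^ 2 / 2) * hs2
  rw [hfac, abs_mul, abs_of_pos (by positivity : (0 : ℝ) < 2 * n ^ 2), abs_mul] at hone
  rw [div_le_iff₀ (by positivity)]
  by_cases hx2 : |x| ≤ 2
  · have hsum : |√2 / 2 + x| ≤ 3 := by
      rw [abs_le] at hx2 ⊢
      constructor <;> linarith
    calc (1 : ℝ) ≤ 2 * n ^ 2 * (|√2 / 2 - x| * |√2 / 2 + x|) := hone
      _ ≤ 2 * n ^ 2 * (|√2 / 2 - x| * 3) := by gcongr
      _ = |√2 / 2 - x| * (6 * n ^ 2) := by ring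
  · have h1 : 1 ≤ |√2 / 2 - x| := by
      have h2 := abs_sub_abs_le_abs_sub x (√2 / 2)
      rw [abs_sub_comm, abs_of_nonneg (by positivity : 0 ≤ √2 / 2)] at h2
      linarith
    nlinarith

/-- For every `δ > 0` there exist `C > 0` and a sequence `(ε_j) ⊆ (0,1)` with
`ε_j → 0`, `ε_j ≥ ε_{j+1} ≥ ε_j/2`, and `dist(ε_j, (1/n)ℤ) ≥ C ε_j e^{-n²π²δ}`
for every `j` and every integer `n ≥ 1`. -/
theorem exists_good_sequence (δ : ℝ) (hδ : 0 < δ) :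
    ∃ C > (0 : ℝ), ∃ ε : ℕ → ℝ,
      (∀ j, ε j ∈ Set.Ioo (0 : ℝ) 1) ∧
      Filter.Tendsto ε Filter.atTop (nhds 0) ∧
      (∀ j, ε (j + 1) ≤ ε j ∧ ε j / 2 ≤ ε (j + 1)) ∧
      (∀ j, ∀ n : ℕ+, C * ε j * Real.exp (-(n : ℝ) ^ 2 * π ^ 2 * δ) ≤ latticeDist (ε j) n) := by
  have hs2 : √2 ^ 2 = 2 := Real.sq_sqrt (by norm_num)
  have hs0 : 0 < √2 := Real.sqrt_pos.mpr (by norm_num)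
  have hs : √2 < 2 := by nlinarith
  refine ⟨π ^ 2 * δ / 6, by positivity, fun j => √2 / 2 * (1 / 2) ^ j, fun j => ⟨by positivity, ?_⟩,
    ?_, fun j => ?_, fun j n => ?_⟩
  · have : ((1 : ℝ) / 2) ^ j ≤ 1 := pow_le_one₀ (by norm_num) (by norm_num)
    have : (0 : ℝ) < (1 / 2) ^ j := by positivity
    nlinarith
  · simpa using (tendsto_pow_atTop_nhds_zero_of_lt_one (by norm_num : (0 : ℝ) ≤ 1 / 2)
      (by norm_num)).const_mul (√2 / 2)
  · have : 0 < √2 / 2 * (1 / 2) ^ j := by positivity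
    constructor <;> simp only [pow_succ] <;> linarith
  · refine le_csInf ⟨_, 0, rfl⟩ ?_
    rintro _ ⟨p, rfl⟩
    have hn : (0 : ℝ) < n := by exact_mod_cast n.pos
    have hexp : π ^ 2 * δ * exp (-(n : ℝ) ^ 2 * π ^ 2 * δ) ≤ 1 / (n : ℝ) ^ 2 := by
      rw [le_div_iff₀ (by positivity), neg_mul, neg_mul, exp_neg, mul_right_comm,
        ← div_eq_mul_inv, div_le_one (exp_pos _)]
      linarith [add_one_le_exp ((n : ℝ) ^ 2 * π ^ 2 * δ)]
    have hbad := inv_six_mul_sq_le_abs_sqrt_two_div_two_sub n (2 ^ j * p)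
    have hscale : √2 / 2 * (1 / 2) ^ j - (p : ℝ) / n =
        (1 / 2) ^ j * (√2 / 2 - ((2 ^ j * p : ℤ) : ℝ) / n) := by
      push_cast
      rw [one_div, inv_pow]
      field_simp
    rw [hscale, abs_mul, abs_of_pos (by positivity : (0 : ℝ) < (1 / 2) ^ j)]
    calc π ^ 2 * δ / 6 * (√2 / 2 * (1 / 2) ^ j) * exp (-(n : ℝ) ^ 2 * π ^ 2 * δ)
        = (√2 / 2) * ((1 / 2) ^ j * (π ^ 2 * δ * exp (-(n : ℝ) ^ 2 * π ^ 2 * δ) / 6)) := by ring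
      _ ≤ 1 * ((1 / 2) ^ j * (1 / (n : ℝ) ^ 2 / 6)) := by
        gcongr
        linarith
      _ = (1 / 2) ^ j * (1 / (6 * (n : ℝ) ^ 2)) := by ring
      _ ≤ _ := by gcongr
end

section
/- Let δ > 0 and c > 0. There exists a constant C > 0, depending only on c, with the following property: for every x₀ ∈ (0,1) and every ε ∈ (0,1) satisfying inf { |ε - p/n| : p ∈ ℤ } ≥ c ε e^{-n²π²δ} for every integer n ≥ 1, one has for every integer n ≥ 1: | ∫_{x₀-ε}^{x₀+ε} sin(nπx) dx | ≥ C ε |sin(nπx₀)| e^{-n²π²δ}. -/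
open MeasureTheory Real Set Filter

/-- The distance to `(1/n)ℤ` is at most the distance to any of its points. -/
lemma latticeDist_le (x : ℝ) (n : ℕ+) (p : ℤ) : latticeDist x n ≤ |x - (p : ℝ) / (n : ℝ)| :=
  csInf_le ⟨0, by rintro _ ⟨q, rfl⟩; positivity⟩ ⟨p, rfl⟩

lemma two_mul_abs_sub_round_le_abs_sin (t : ℝ) : 2 * |t - round t| ≤ |Real.sin (π * t)| := by
  have habs : |π * (t - round t)| = π * |t - round t| := by rw [abs_mul, abs_of_pos pi_pos]
  have hsin : |Real.sin (π * (t - round t))| = |Real.sin (π * t)| := by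
    rw [mul_sub, mul_comm π (round t : ℝ), Real.sin_sub_int_mul_pi, abs_mul]
    simp
  have hle : |π * (t - round t)| ≤ π / 2 := by
    rw [habs]
    nlinarith [abs_sub_round t, pi_pos]
  have h := Real.mul_abs_le_abs_sin hle
  rw [hsin, habs] at h
  convert h using 1
  field_simp

lemma two_mul_latticeDist_le_abs_sin (x : ℝ) (n : ℕ+) :
    2 * ((n : ℝ) * latticeDist x n) ≤ |Real.sin (n * π * x)| := by
  have hn : (0 : ℝ) < n := by exact_mod_cast n.pos
  have h : (n : ℝ) * latticeDist x n ≤ |n * x - round ((n : ℝ) * x)| :=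
    calc (n : ℝ) * latticeDist x n ≤ n * |x - (round ((n : ℝ) * x) : ℝ) / n| := by
          gcongr
          exact latticeDist_le x n _
      _ = |n * x - round ((n : ℝ) * x)| := by
          nth_rewrite 1 [← abs_of_pos hn]
          rw [← abs_mul]
          congr 1
          field_simp
  calc 2 * ((n : ℝ) * latticeDist x n) ≤ 2 * |n * x - round ((n : ℝ) * x)| := by gcongr
    _ ≤ |Real.sin (π * (n * x))| := two_mul_abs_sub_round_le_abs_sin _
    _ = |Real.sin (n * π * x)| := by ring_nf

lemma integral_sin_mul_symm {a : ℝ} (ha : a ≠ 0) (x₀ ε : ℝ) :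
    ∫ x in (x₀ - ε)..(x₀ + ε), Real.sin (a * x) =
      2 / a * (Real.sin (a * x₀) * Real.sin (a * ε)) := by
  rw [intervalIntegral.integral_comp_mul_left Real.sin ha, integral_sin, mul_sub, mul_add,
    Real.cos_sub, Real.cos_add, smul_eq_mul]
  ring

/-- There is a constant `C > 0` depending only on `c` such that: for every `δ > 0`,
every `x₀ ∈ (0,1)` and every `ε ∈ (0,1)` with `dist(ε, (1/n)ℤ) ≥ c ε e^{-n²π²δ}` for all
`n ≥ 1`, one has `|∫_{x₀-ε}^{x₀+ε} sin(nπx) dx| ≥ C ε |sin(nπx₀)| e^{-n²π²δ}` for all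
`n ≥ 1`. -/
theorem integral_sin_lower_bound (c : ℝ) (hc : 0 < c) :
    ∃ C > (0 : ℝ), ∀ δ : ℝ, 0 < δ → ∀ x₀ ∈ Set.Ioo (0 : ℝ) 1, ∀ ε ∈ Set.Ioo (0 : ℝ) 1,
      (∀ n : ℕ+, c * ε * Real.exp (-(n : ℝ) ^ 2 * π ^ 2 * δ) ≤ latticeDist ε n) →
      ∀ n : ℕ+,
        C * ε * |Real.sin ((n : ℝ) * π * x₀)| * Real.exp (-(n : ℝ) ^ 2 * π ^ 2 * δ) ≤
          |∫ x in (x₀ - ε)..(x₀ + ε), Real.sin ((n : ℝ) * π * x)| := by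
  refine ⟨c, hc, fun δ _ x₀ _ ε _ h n => ?_⟩
  have hn : (0 : ℝ) < n := by exact_mod_cast n.pos
  have hnπ : 0 < (n : ℝ) * π := by positivity
  rw [integral_sin_mul_symm hnπ.ne', abs_mul, abs_mul, abs_of_pos (div_pos two_pos hnπ)]
  have hsin := two_mul_latticeDist_le_abs_sin ε n
  set E := Real.exp (-(n : ℝ) ^ 2 * π ^ 2 * δ)
  have hdist : latticeDist ε n ≤ 2 / (n * π) * |Real.sin (n * π * ε)| := by
    rw [div_mul_eq_mul_div, le_div_iff₀ hnπ]
    have hnonneg : 0 ≤ latticeDist ε n :=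
      Real.sInf_nonneg (by rintro _ ⟨p, rfl⟩; positivity)
    nlinarith [pi_le_four, mul_nonneg hn.le hnonneg]
  calc c * ε * |Real.sin (n * π * x₀)| * E = |Real.sin (n * π * x₀)| * (c * ε * E) := by ring
    _ ≤ |Real.sin (n * π * x₀)| * (2 / (n * π) * |Real.sin (n * π * ε)|) :=
        mul_le_mul_of_nonneg_left ((h n).trans hdist) (abs_nonneg _)
    _ = 2 / (n * π) * (|Real.sin (n * π * x₀)| * |Real.sin (n * π * ε)|) := by ring
end

section
/- Let x₀ be an irrational real number that is algebraic of degree m ≥ 2 over ℚ. Then for every T > 0 the series Σ_{n≥1} e^{-n²π²T}/|sin(nπx₀)| converges (note that sin(nπx₀) ≠ 0 for every n ≥ 1 since x₀ is irrational). Consequently, by Dolecki's theorem, the minimal time of pointwise control of the 1D heat equation at x₀ is T₀ = 0. -/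
open Real

theorem two_mul_abs_sub_round_le_abs_sin_pi_mul (x : ℝ) :
    2 * |x - round x| ≤ |Real.sin (π * x)| := by
  have hpi := Real.pi_pos
  have habs : |π * (x - round x)| = π * |x - round x| := by
    rw [abs_mul, abs_of_pos hpi]
  have hsin : |Real.sin (π * (x - round x))| = |Real.sin (π * x)| := by
    rw [mul_sub, mul_comm π (round x : ℝ), Real.sin_sub_int_mul_pi, abs_mul, abs_neg_one_zpow,
      one_mul]
  have h := Real.mul_abs_le_abs_sin (x := π * (x - round x)) (by
    rw [habs]
    nlinarith [abs_sub_round x])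
  rwa [hsin, habs, ← mul_assoc, div_mul_cancel₀ _ hpi.ne'] at h

theorem exists_inv_abs_sin_le_of_isAlgebraic {x : ℝ} (hirr : Irrational x)
    (halg : IsAlgebraic ℚ x) :
    ∃ (A : ℝ) (d : ℕ), ∀ n : ℕ, 0 < n → |Real.sin (n * π * x)|⁻¹ ≤ A * (n : ℝ) ^ d := by
  obtain ⟨f, hf, hfx⟩ := (IsFractionRing.isAlgebraic_iff ℤ ℚ ℝ).mpr halg
  rw [← Polynomial.eval_map_algebraMap] at hfx
  obtain ⟨A, hA, h⟩ := Liouville.exists_pos_real_of_irrational_root hirr hf hfx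
  refine ⟨A, f.natDegree, fun n hn => ?_⟩
  have hn1 : (1 : ℝ) ≤ n := by exact_mod_cast hn
  have hliou := h (round (n * x)) (n - 1)
  rw [Nat.cast_pred hn, sub_add_cancel] at hliou
  have hsin := two_mul_abs_sub_round_le_abs_sin_pi_mul (n * x)
  rw [show π * (n * x) = n * π * x by ring] at hsin
  have hdist : |x - round (n * x) / n| ≤ |n * x - round (n * x)| := by
    rw [show (n : ℝ) * x - round (n * x) = n * (x - round (n * x) / n) by field_simp,
      abs_mul, Nat.abs_cast]
    exact le_mul_of_one_le_left (abs_nonneg _) hn1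
  have hle : |x - round (n * x) / n| ≤ |Real.sin (n * π * x)| := by
    linarith [abs_nonneg ((n : ℝ) * x - round (n * x))]
  have hone : 1 ≤ A * (n : ℝ) ^ f.natDegree * |Real.sin (n * π * x)| :=
    calc (1 : ℝ) ≤ (n : ℝ) ^ f.natDegree * (|x - round (n * x) / n| * A) := hliou
      _ ≤ (n : ℝ) ^ f.natDegree * (|Real.sin (n * π * x)| * A) := by gcongr
      _ = _ := by ring
  have hpos : 0 < |Real.sin (n * π * x)| := by
    refine (abs_nonneg _).lt_of_ne fun h0 => ?_
    rw [← h0, mul_zero] at hone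
    linarith
  rwa [inv_le_iff_one_le_mul₀ hpos]

/-- If `x₀` is an irrational algebraic number of degree `m ≥ 2` over `ℚ`, then for every
`T > 0` the Dolecki series `Σ e^{-n²π²T}/|sin(nπx₀)|` converges; hence the minimal
pointwise control time at `x₀` is `T₀ = 0`. -/
theorem dolecki_series_summable_of_algebraic (x₀ : ℝ) (m : ℕ) (hm : 2 ≤ m)
    (hirr : Irrational x₀) (halg : IsAlgebraic ℚ x₀)
    (hdeg : (minpoly ℚ x₀).natDegree = m) :
    ∀ T : ℝ, 0 < T →
      Summable (fun n : ℕ+ =>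
        Real.exp (-(n : ℝ) ^ 2 * π ^ 2 * T) / |Real.sin ((n : ℝ) * π * x₀)|) := by
  intro T hT
  obtain ⟨A, d, h⟩ := exists_inv_abs_sin_le_of_isAlgebraic hirr halg
  have hr : 0 < π ^ 2 * T := by positivity
  have hsum := ((Real.summable_pow_mul_exp_neg_nat_mul d hr).mul_left A).comp_injective
    PNat.coe_injective
  refine Summable.of_nonneg_of_le (fun n => by positivity) (fun n => ?_) hsum
  have hn1 : (1 : ℝ) ≤ (n : ℕ) := by exact_mod_cast n.pos
  have hexp : Real.exp (-(n : ℝ) ^ 2 * π ^ 2 * T) ≤ Real.exp (-(π ^ 2 * T) * (n : ℕ)) := by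
    rw [Real.exp_le_exp]
    nlinarith [mul_le_mul_of_nonneg_left (le_self_pow₀ hn1 two_ne_zero) hr.le]
  calc Real.exp (-(n : ℝ) ^ 2 * π ^ 2 * T) / |Real.sin ((n : ℝ) * π * x₀)|
      = |Real.sin ((n : ℝ) * π * x₀)|⁻¹ * Real.exp (-(n : ℝ) ^ 2 * π ^ 2 * T) := by
        rw [div_eq_mul_inv, mul_comm]
    _ ≤ A * (n : ℝ) ^ d * Real.exp (-(π ^ 2 * T) * (n : ℕ)) :=
        mul_le_mul (h n n.pos) hexp (Real.exp_nonneg _)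
          ((inv_nonneg.mpr (abs_nonneg _)).trans (h n n.pos))
    _ = _ := mul_assoc _ _ _
end
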